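/- Let p, q be positive integers, n ≥ 2, and a ∈ (0, 1/√2). Let (u, v₁, v₂) ∈ ℂ^{n−1}×ℂ×ℂ with ‖u‖² = 1 − 2a², |v₁| = |v₂| = a. Set X₁ := (0, i·v₁, 0), X₂ := (0, 0, i·v₂) and w := (i·p·u, i·q·v₁, i·q·v₂). Then for j, k ∈ {1,2} the horizontal parts with respect to w satisfy ⟨X_jʰ, X_kʰ⟩ = δ_{jk}·a² − q²a⁴/(p²(1−2a²) + 2q²a²). -/

import Mathlib

open Matrix

/-- The Hermitian inner product `⟪z,w⟫ = ∑ k, z k * conj (w k)` on `ℂᵐ`. -/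
noncomputable def hinner {m : ℕ} (z w : Fin m → ℂ) : ℂ :=
  ∑ k, z k * (starRingEnd ℂ) (w k)

/-- The real inner product `⟨z,w⟩ = Re ⟪z,w⟫` on `ℂᵐ`. -/
noncomputable def rinner {m : ℕ} (z w : Fin m → ℂ) : ℝ := (hinner z w).re

/-- The squared norm `‖z‖² = ⟨z,z⟩` on `ℂᵐ`. -/
noncomputable def nsq {m : ℕ} (z : Fin m → ℂ) : ℝ := rinner z z

/-- The 1-form `κ^j_u(U) = ‖u‖²⟨ju,U⟩ − ⟨U,iu⟩⟨ju,iu⟩` associated with a matrix `j`. -/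
noncomputable def kappa {m : ℕ} (j : Matrix (Fin m) (Fin m) ℂ) (u U : Fin m → ℂ) : ℝ :=
  nsq u * rinner (j.mulVec u) U -
    rinner U (Complex.I • u) * rinner (j.mulVec u) (Complex.I • u)

/-- The space `ℂᵐ × ℂ × ℂ`. -/
abbrev E (m : ℕ) := (Fin m → ℂ) × ℂ × ℂ

/-- The real inner product `⟨z,w⟩ = Re(z·conj w)` on `ℂ`. -/
noncomputable def rc (z w : ℂ) : ℝ := (z * (starRingEnd ℂ) w).re

/-- The real inner product on `ℂᵐ × ℂ × ℂ`. -/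
noncomputable def ripE {m : ℕ} (x y : E m) : ℝ :=
  rinner x.1 y.1 + rc x.2.1 y.2.1 + rc x.2.2 y.2.2

/-- The horizontal part `Xʰ = X − (⟨X,w⟩/‖w‖²)·w` of `X` with respect to `w`. -/
noncomputable def hor {m : ℕ} (w X : E m) : E m :=
  X - (ripE X w / ripE w w) • w

theorem rc_eq (z w : ℂ) : rc z w = z.re * w.re + z.im * w.im := by
  simp [rc]

theorem rinner_eq_sum_rc {m : ℕ} (z w : Fin m → ℂ) : rinner z w = ∑ k, rc (z k) (w k) := by
  simp [rinner, hinner, rc]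

theorem rc_self (z : ℂ) : rc z z = ‖z‖ ^ 2 := by
  rw [rc_eq, ← Complex.normSq_eq_norm_sq, Complex.normSq_apply]

theorem rc_comm (z w : ℂ) : rc z w = rc w z := by
  simp only [rc_eq]; ring

theorem rc_sub_smul_left (x y z : ℂ) (r : ℝ) : rc (x - r • y) z = rc x z - r * rc y z := by
  simp only [rc_eq, Complex.sub_re, Complex.sub_im, Complex.smul_re, Complex.smul_im, smul_eq_mul]
  ring

theorem ripE_comm {m : ℕ} (x y : E m) : ripE x y = ripE y x := by
  simp only [ripE, rinner_eq_sum_rc, rc_comm]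

theorem ripE_sub_smul_left {m : ℕ} (x y z : E m) (r : ℝ) :
    ripE (x - r • y) z = ripE x z - r * ripE y z := by
  simp only [ripE, rinner_eq_sum_rc, Prod.fst_sub, Prod.snd_sub, Prod.smul_fst, Prod.smul_snd,
    Pi.sub_apply, Pi.smul_apply, rc_sub_smul_left, Finset.sum_sub_distrib, ← Finset.mul_sum]
  ring

theorem ripE_hor_hor {m : ℕ} (w x y : E m) (hw : ripE w w ≠ 0) :
    ripE (hor w x) (hor w y) = ripE x y - ripE x w * ripE y w / ripE w w := by
  have h (z : E m) : ripE z (hor w y) = ripE z y - ripE y w / ripE w w * ripE z w := by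
    rw [ripE_comm, hor, ripE_sub_smul_left, ripE_comm y z, ripE_comm w z]
  rw [h, hor, ripE_sub_smul_left, ripE_sub_smul_left, ripE_comm w y]
  field_simp
  ring

theorem rc_I_mul_natCast_mul (c d : ℕ) (z : ℂ) :
    rc ((c : ℂ) * Complex.I * z) ((d : ℂ) * Complex.I * z) = c * d * ‖z‖ ^ 2 := by
  rw [← rc_self]
  simp [rc_eq]
  ring

theorem rinner_natCast_mul_I_smul_self {m : ℕ} (c : ℕ) (u : Fin m → ℂ) :
    rinner (((c : ℂ) * Complex.I) • u) (((c : ℂ) * Complex.I) • u) = (c : ℝ) ^ 2 * nsq u := by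
  simp only [nsq, rinner_eq_sum_rc, Pi.smul_apply, smul_eq_mul, rc_I_mul_natCast_mul,
    Finset.mul_sum]
  simp only [rc_self, sq]

/-- Corollary 4.13(i) of the paper, computed at points of `O_{a,a}`:
`⟨X_jʰ, X_kʰ⟩ = δ_{jk}a² − q²a⁴/(p²(1−2a²)+2q²a²)`. -/
theorem horizontal_gram_diag (p q n : ℕ) (hp : 0 < p) (hq : 0 < q) (hn : 2 ≤ n)
    (a : ℝ) (ha : a ∈ Set.Ioo 0 (1 / Real.sqrt 2))
    (u : Fin (n - 1) → ℂ) (v : Fin 2 → ℂ)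
    (hu : nsq u = 1 - 2 * a ^ 2) (hv0 : ‖v 0‖ = a) (hv1 : ‖v 1‖ = a)
    (X : Fin 2 → E (n - 1)) (w : E (n - 1))
    (hX0 : X 0 = (0, Complex.I * v 0, 0)) (hX1 : X 1 = (0, 0, Complex.I * v 1))
    (hw : w = (((p : ℂ) * Complex.I) • u, (q : ℂ) * Complex.I * v 0, (q : ℂ) * Complex.I * v 1)) :
    ∀ j k : Fin 2,
      ripE (hor w (X j)) (hor w (X k)) =
        (if j = k then a ^ 2 else 0) -
          (q : ℝ) ^ 2 * a ^ 4 / ((p : ℝ) ^ 2 * (1 - 2 * a ^ 2) + 2 * (q : ℝ) ^ 2 * a ^ 2) := by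
  have ha2 : 2 * a ^ 2 < 1 := by
    have h := pow_lt_pow_left₀ ha.2 ha.1.le two_ne_zero
    rw [div_pow, Real.sq_sqrt zero_le_two] at h
    linarith
  have ha0 : 0 < a := ha.1
  have hp' : (0 : ℝ) < p := Nat.cast_pos.mpr hp
  have hq' : (0 : ℝ) < q := Nat.cast_pos.mpr hq
  have rc_I (z : ℂ) : rc (Complex.I * z) ((q : ℂ) * Complex.I * z) = q * ‖z‖ ^ 2 := by
    simpa using rc_I_mul_natCast_mul 1 q z
  have rc_I_I (z : ℂ) : rc (Complex.I * z) (Complex.I * z) = ‖z‖ ^ 2 := by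
    simpa using rc_I_mul_natCast_mul 1 1 z
  have rc_zero_left (z : ℂ) : rc 0 z = 0 := by simp [rc]
  have rc_zero_right (z : ℂ) : rc z 0 = 0 := by simp [rc]
  have rinner_zero_left (z : Fin (n - 1) → ℂ) : rinner 0 z = 0 := by simp [rinner, hinner]
  have hww : ripE w w = (p : ℝ) ^ 2 * (1 - 2 * a ^ 2) + 2 * (q : ℝ) ^ 2 * a ^ 2 := by
    simp only [hw, ripE, rinner_natCast_mul_I_smul_self, rc_I_mul_natCast_mul, hu, hv0, hv1]
    ring
  have hpos : 0 < ripE w w := by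
    have : 0 < 1 - 2 * a ^ 2 := by linarith
    rw [hww]
    positivity
  have hXw (j : Fin 2) : ripE (X j) w = q * a ^ 2 := by
    fin_cases j <;>
      simp [hX0, hX1, hw, ripE, rc_I, rc_zero_left, rinner_zero_left, hv0, hv1]
  have hXX (j k : Fin 2) : ripE (X j) (X k) = if j = k then a ^ 2 else 0 := by
    fin_cases j <;> fin_cases k <;>
      simp [hX0, hX1, ripE, rc_I_I, rc_zero_left, rc_zero_right, rinner_zero_left, hv0, hv1]
  intro j k
  rw [ripE_hor_hor w _ _ hpos.ne', hXX, hXw, hXw, hww]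
  ring
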